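/- Edge gadget (Lemma on (v^1, j_1, k_1, v^2, j_2, k_2)-edge gadgets): for all k_1, k_2 ∈ ℕ and j_1, j_2 ∈ ℕ there exists an SRTI instance consisting of a gadget graph together with two additional vertices v^1 and v^2, where for i ∈ {1,2} the only edge incident to v^i is e_i = {v^i, w^i} with w^i in the gadget and rk_{v^i}(w^i) = j_i, such that for every subset S ⊆ {e_1, e_2} there exists a stable matching M of the instance with M ∩ {e_1, e_2} = S, and among all such stable matchings the maximum number of edges of M having at least one endpoint in the gadget equals: 6 + 2k_1 + 2k_2 if S = {e_1, e_2}; 5 + 2k_i + k_{3−i} if S = {e_i} for exactly one i ∈ {1,2}; and 5 + k_1 + k_2 if S = ∅. Moreover the gadget has O(k_1 + k_2) vertices and tree-cut width at most 10. -/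

import Mathlib

open scoped Classical

noncomputable section

/-- A multigraph on an ambient type `A`: a set of vertices together with an
edge-multiplicity function on unordered pairs (loops allowed). -/
structure Multigraph (A : Type) where
  verts : Set A
  mult : Sym2 A → ℕ

namespace Multigraph

variable {A : Type} [Fintype A]

/-- The degree of a vertex in a multigraph; a loop contributes `2` to the degree. -/
def deg (M : Multigraph A) (x : A) : ℕ :=
  (∑ y : A, M.mult s(x, y)) + M.mult s(x, x)

/-- Suppressing the vertex `v`: delete `v` (and all edges incident to it) and, if `v`
had exactly two edge-endpoints at distinct neighbours `a`, `b`, add an edge `{a,b}`;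
if `v` had a double edge to a vertex `a`, add a loop at `a`.  (The formula below is
the intended operation when `deg v ≤ 2`.) -/
def suppress (M : Multigraph A) (v : A) : Multigraph A where
  verts := M.verts \ {v}
  mult := Sym2.lift ⟨fun x y =>
    if x = v ∨ y = v then 0
    else M.mult s(x, y) +
      (if x = y then (if M.mult s(v, x) = 2 then 1 else 0)
       else min (M.mult s(v, x)) 1 * min (M.mult s(v, y)) 1),
    by
      intro x y
      rcases eq_or_ne x y with rfl | hxy
      · rfl
      · dsimp only
        by_cases h : x = v ∨ y = v
        · rw [if_pos h, if_pos (Or.symm h)]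
        · rw [if_neg h, if_neg (fun hc => h (Or.symm hc)), if_neg hxy, if_neg (Ne.symm hxy)]
          have h1 : s(x, y) = s(y, x) := Sym2.eq_swap
          rw [h1, Nat.mul_comm]⟩

/-- One step of suppression: suppress some vertex of degree at most `2`. -/
def SuppressStep (M M' : Multigraph A) : Prop :=
  ∃ v ∈ M.verts, M.deg v ≤ 2 ∧ M' = M.suppress v

/-- A multigraph in which no vertex of degree at most `2` is left. -/
def Reduced (M : Multigraph A) : Prop := ∀ v ∈ M.verts, 3 ≤ M.deg v

/-- The number of vertices remaining after exhaustively suppressing vertices of degree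
at most `2`. -/
def reducedSize (M : Multigraph A) : ℕ :=
  sInf {n | ∃ M' : Multigraph A,
    Relation.ReflTransGen SuppressStep M M' ∧ M'.Reduced ∧ n = M'.verts.ncard}

end Multigraph

/-- A (rooted) tree-cut decomposition of a graph on vertex type `V`: a tree `T` on a
node type `N`, a root, and a near-partition of `V` into bags indexed by the nodes. -/
structure TreeCutDecomp (N V : Type) where
  T : SimpleGraph N
  connected : T.Connected
  acyclic : T.IsAcyclic
  root : N
  bag : N → Set V
  bag_disjoint : ∀ s t : N, s ≠ t → Disjoint (bag s) (bag t)
  bag_cover : ∀ v : V, ∃ t : N, v ∈ bag t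

namespace TreeCutDecomp

variable {N V : Type} [Fintype N] [Fintype V] (D : TreeCutDecomp N V)

/-- The nodes in the subtree rooted at `t`: those nodes whose every walk to the root
passes through `t`. -/
def subtree (t : N) : Set N := {u | ∀ p : D.T.Walk u D.root, t ∈ p.support}

/-- The set of graph vertices contained in bags of the subtree rooted at `t`. -/
def Yset (t : N) : Set V := {v | ∃ u ∈ D.subtree t, v ∈ D.bag u}

/-- The adhesion of a node `t`: the number of edges of `G` crossing between the vertices
below `t` and the remaining vertices (this is `cut(e(t))` for `t ≠ root`, and `0` for
the root). -/
def adh (G : SimpleGraph V) (t : N) : ℕ :=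
  Set.ncard {e : Sym2 V | e ∈ G.edgeSet ∧
    ∃ x y : V, e = s(x, y) ∧ x ∈ D.Yset t ∧ y ∉ D.Yset t}

/-- The nodes in the component of `T - t` containing the neighbour `s` of `t`:
those nodes whose every walk to `t` passes through `s`. -/
def branch (t s : N) : Set N := {u | ∀ p : D.T.Walk u t, s ∈ p.support}

/-- Some node whose bag contains `v`. -/
def nodeOf (v : V) : N := @Classical.epsilon N ⟨D.root⟩ (fun u => v ∈ D.bag u)

/-- The projection used to build the torso at `t`: vertices in the bag of `t` are kept,
and any other vertex is mapped to (the contracted vertex corresponding to) the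
component of `T - t` containing its bag's node, represented by the neighbour `s` of `t`
in that component. -/
def proj (t : N) (v : V) : V ⊕ N :=
  if v ∈ D.bag t then Sum.inl v
  else Sum.inr (@Classical.epsilon N ⟨D.root⟩
    (fun s => D.T.Adj t s ∧ D.nodeOf v ∈ D.branch t s))

/-- The torso of the decomposition at node `t`: the multigraph obtained from `G` by
contracting, for each component of `T - t`, the union of bags of that component into a
single vertex (no loops are created; parallel edges are counted with multiplicity). -/
def torso (G : SimpleGraph V) (t : N) : Multigraph (V ⊕ N) where
  verts := (Sum.inl '' D.bag t) ∪ (Sum.inr '' (D.T.neighborSet t))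
  mult := fun e => Set.ncard {f : Sym2 V | f ∈ G.edgeSet ∧
    Sym2.map (D.proj t) f = e ∧ ¬ (Sym2.map (D.proj t) f).IsDiag}

/-- The torso-size of a node `t`: the number of vertices left after exhaustively
suppressing vertices of degree at most `2` in the torso at `t`. -/
def tor (G : SimpleGraph V) (t : N) : ℕ := (D.torso G t).reducedSize

/-- The width of the tree-cut decomposition. -/
def width (G : SimpleGraph V) : ℕ :=
  Finset.univ.sup fun t : N => max (D.adh G t) (D.tor G t)

end TreeCutDecomp

/-- The tree-cut width of a graph: the minimum width of a (rooted) tree-cut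
decomposition. -/
def tcw {V : Type} [Fintype V] (G : SimpleGraph V) : ℕ :=
  sInf {w | ∃ (N : Type) (_ : Fintype N) (D : TreeCutDecomp N V), D.width G = w}


/-- A matching of a graph `G`, given by the partner function: `partner v = v` means
that `v` is unmatched, and otherwise `v` is matched to `partner v`, which must be one
of its neighbours in the acceptability graph `G`. -/
structure Matching {V : Type} (G : SimpleGraph V) where
  partner : V → V
  involutive : ∀ v, partner (partner v) = v
  adj_of_ne : ∀ v, partner v ≠ v → G.Adj v (partner v)

/-- The set of edges of a matching. -/
def Matching.edgeSet {V : Type} {G : SimpleGraph V} (M : Matching G) : Set (Sym2 V) :=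
  {e | ∃ v, M.partner v ≠ v ∧ e = s(v, M.partner v)}

/-- The pair `{v, w}` is blocking for the matching `M` (with respect to the rank
functions `rk`, where `rk v w = ⊤` encodes that `v` prefers any acceptable partner to
`w`; in particular `rk v v = ⊤`, so that an unmatched agent prefers every neighbour to
staying alone): `v` and `w` are adjacent, and each strictly prefers the other to its
current situation. -/
def IsBlocking {V : Type} (G : SimpleGraph V) (rk : V → V → ℕ∞) (M : Matching G)
    (v w : V) : Prop :=
  G.Adj v w ∧ rk v w < rk v (M.partner v) ∧ rk w v < rk w (M.partner w)

/-- A matching is stable if no edge of `G` is blocking. -/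
def Stable {V : Type} (G : SimpleGraph V) (rk : V → V → ℕ∞) (M : Matching G) : Prop :=
  ∀ v w : V, ¬ IsBlocking G rk M v w

/-- The number of edges of the matching `M` having at least one endpoint in the gadget,
i.e. at least one endpoint distinct from both outer vertices `v₁`, `v₂`. -/
def gadgetEdgeCount {n : ℕ} {H : SimpleGraph (Fin n)} (v₁ v₂ : Fin n)
    (M : Matching H) : ℕ :=
  Set.ncard {e | e ∈ M.edgeSet ∧ ∃ x ∈ e, x ≠ v₁ ∧ x ≠ v₂}

namespace Multigraph

variable {A : Type} [Fintype A]

theorem suppress_mult_le (M : Multigraph A) (v : A) (hv : M.deg v ≤ 1) (e : Sym2 A) :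
    (M.suppress v).mult e ≤ M.mult e := by
  induction e using Sym2.ind with
  | _ x y =>
  change (if x = v ∨ y = v then 0
    else M.mult s(x, y) +
      (if x = y then (if M.mult s(v, x) = 2 then 1 else 0)
       else min (M.mult s(v, x)) 1 * min (M.mult s(v, y)) 1)) ≤ _
  unfold deg at hv
  have h1 : ∀ z, M.mult s(v, z) ≤ 1 := by
    intro z
    have := Finset.single_le_sum (f := fun y => M.mult s(v, y)) (fun _ _ => Nat.zero_le _)
      (Finset.mem_univ z)
    have this' : M.mult s(v, z) ≤ ∑ y : A, M.mult s(v, y) := this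
    omega
  split_ifs with h2 h3 h4
  · exact Nat.zero_le _
  · have := h1 x
    omega
  · simp
  · have h5 : M.mult s(v, x) + M.mult s(v, y) ≤ 1 := by
      have h6 : ∑ z ∈ ({x, y} : Finset A), M.mult s(v, z) ≤ ∑ z : A, M.mult s(v, z) :=
        Finset.sum_le_sum_of_subset (Finset.subset_univ _)
      rw [Finset.sum_pair h3] at h6
      omega
    have h7 : M.mult s(v, x) = 0 ∨ M.mult s(v, y) = 0 := by omega
    rcases h7 with h7 | h7 <;> simp [h7]

theorem suppress_deg_le (M : Multigraph A) (v : A) (hv : M.deg v ≤ 1) (x : A) :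
    (M.suppress v).deg x ≤ M.deg x := by
  unfold deg
  gcongr <;> exact suppress_mult_le M v hv _

theorem exists_reduced : ∀ (n : ℕ) (M : Multigraph A), M.verts.ncard = n →
    ∃ M' : Multigraph A, Relation.ReflTransGen SuppressStep M M' ∧ M'.Reduced ∧
      M'.verts.ncard ≤ n := by
  intro n
  induction n with
  | zero =>
    intro M hM
    refine ⟨M, Relation.ReflTransGen.refl, ?_, hM.le⟩
    intro v hv
    rw [Set.ncard_eq_zero (Set.toFinite _)] at hM
    simp [hM] at hv
  | succ n ih =>
    intro M hM
    by_cases h : M.Reduced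
    · exact ⟨M, Relation.ReflTransGen.refl, h, hM.le⟩
    · unfold Reduced at h
      push Not at h
      obtain ⟨v, hv, hd⟩ := h
      have hc : (M.suppress v).verts.ncard = n := by
        change (M.verts \ {v}).ncard = n
        rw [Set.ncard_sdiff_singleton_of_mem hv, hM]
        rfl
      obtain ⟨M', h1, h2, h3⟩ := ih _ hc
      exact ⟨M', Relation.ReflTransGen.head ⟨v, hv, by omega, rfl⟩ h1, h2, by omega⟩

theorem exists_strip (B : Finset A) : ∀ (M : Multigraph A), (∀ x ∈ B, x ∈ M.verts) →
    (∀ x ∈ B, M.deg x ≤ 1) →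
    ∃ M' : Multigraph A, Relation.ReflTransGen SuppressStep M M' ∧ M'.verts = M.verts \ B := by
  induction B using Finset.induction_on with
  | empty => intro M _ _; exact ⟨M, Relation.ReflTransGen.refl, by simp⟩
  | insert a s ha ih =>
    intro M h1 h2
    have hd := h2 a (Finset.mem_insert_self _ _)
    obtain ⟨M', h3, h4⟩ := ih (M.suppress a)
      (by
        intro x hx
        refine ⟨h1 x (Finset.mem_insert_of_mem hx), ?_⟩
        rintro rfl
        exact ha hx)
      (fun x hx => (suppress_deg_le M a hd x).trans (h2 x (Finset.mem_insert_of_mem hx)))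
    refine ⟨M', Relation.ReflTransGen.head ⟨a, h1 a (Finset.mem_insert_self _ _),
      by omega, rfl⟩ h3, ?_⟩
    rw [h4]
    change (M.verts \ {a}) \ _ = _
    ext z
    simp
    tauto

theorem reducedSize_le (M : Multigraph A) (B : Finset A) (h1 : ∀ x ∈ B, x ∈ M.verts)
    (h2 : ∀ x ∈ B, M.deg x ≤ 1) : M.reducedSize ≤ (M.verts \ B).ncard := by
  obtain ⟨M', h3, h4⟩ := exists_strip B M h1 h2
  obtain ⟨M'', h5, h6, h7⟩ := exists_reduced _ M' rfl
  rw [h4] at h7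
  have h8 : M.reducedSize ≤ M''.verts.ncard := by
    unfold reducedSize
    exact Nat.sInf_le ⟨M'', h3.trans h5, h6, rfl⟩
  exact h8.trans h7

end Multigraph

/-- The star tree-cut decomposition associated with a map to `Option L`. -/
def starDecomp {W L : Type} (node : W → Option L) : TreeCutDecomp (Option L) W where
  T := SimpleGraph.starGraph none
  connected := (SimpleGraph.isTree_starGraph (r := none)).1
  acyclic := (SimpleGraph.isTree_starGraph (r := none)).2
  root := none
  bag := fun t => {x | node x = t}
  bag_disjoint := by
    intro s t hst
    rw [Set.disjoint_left]
    intro x hx hx'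
    exact hst (hx.symm.trans hx')
  bag_cover := fun v => ⟨node v, rfl⟩

theorem starDecomp_nodeOf {W L : Type} (node : W → Option L) (x : W) :
    (starDecomp node).nodeOf x = node x := by
  have : x ∈ (starDecomp node).bag ((starDecomp node).nodeOf x) :=
    @Classical.epsilon_spec_aux (Option L) ⟨none⟩ (fun u => x ∈ (starDecomp node).bag u) ⟨node x, rfl⟩
  exact this.symm

theorem star_walk {L : Type} {s : Option L} {l : L}
    (h : ∀ p : (SimpleGraph.starGraph (none : Option L)).Walk (some l) none, s ∈ p.support) :
    s = some l ∨ s = none := by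
  have hadj : (SimpleGraph.starGraph (none : Option L)).Adj (some l) none := by simp
  have := h (SimpleGraph.Walk.cons hadj SimpleGraph.Walk.nil)
  simpa using this

theorem starDecomp_proj {W L : Type} (node : W → Option L) (x : W) (l : L)
    (hx : node x = some l) : (starDecomp node).proj none x = Sum.inr (some l) := by
  unfold TreeCutDecomp.proj
  have h0 : x ∉ (starDecomp node).bag none := by
    change ¬ (node x = none)
    simp [hx]
  rw [if_neg h0]
  congr 1
  have hex : ∃ s, (starDecomp node).T.Adj none s ∧
      (starDecomp node).nodeOf x ∈ (starDecomp node).branch none s := by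
    refine ⟨some l, ?_, ?_⟩
    · change (SimpleGraph.starGraph (none : Option L)).Adj none (some l)
      simp
    · rw [starDecomp_nodeOf, hx]
      intro p
      exact p.start_mem_support
  have := @Classical.epsilon_spec_aux (Option L) ⟨none⟩ _ hex
  obtain ⟨h1, h2⟩ := this
  have h2' : ∀ s, (starDecomp node).nodeOf x ∈ (starDecomp node).branch none s →
      s = some l ∨ s = none := by
    intro s hs
    rw [starDecomp_nodeOf, hx] at hs
    exact star_walk hs
  rcases h2' _ h2 with h3 | h3
  · exact h3
  · exact absurd h3 h1.ne'

theorem starDecomp_proj_none {W L : Type} (node : W → Option L) (x : W)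
    (hx : node x = none) : (starDecomp node).proj none x = Sum.inl x := by
  unfold TreeCutDecomp.proj
  have h0 : x ∈ (starDecomp node).bag none := hx
  rw [if_pos h0]

theorem tcw_star {W L : Type} [Fintype W] [Fintype L] (G : SimpleGraph W) (node : W → Option L)
    (m : ℕ) (hm : 1 ≤ m)
    (hroot : {x | node x = none}.ncard ≤ m)
    (hleaf : ∀ l, {x | node x = some l}.ncard + 1 ≤ m)
    (hcut : ∀ l, ∃ e0, ∀ x y, G.Adj x y → node x = some l → node y ≠ some l → s(x, y) = e0) :
    tcw G ≤ m := by
  have key : (starDecomp node).width G ≤ m := by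
    unfold TreeCutDecomp.width
    rw [Finset.sup_le_iff]
    rintro t -
    rw [max_le_iff]
    constructor
    · cases t with
      | none =>
        have : {e : Sym2 W | e ∈ G.edgeSet ∧ ∃ x y : W, e = s(x, y) ∧
            x ∈ (starDecomp node).Yset none ∧ y ∉ (starDecomp node).Yset none} = ∅ := by
          rw [Set.eq_empty_iff_forall_notMem]
          rintro e ⟨-, x, y, -, -, hy⟩
          exact hy ⟨node y, fun p => p.end_mem_support, rfl⟩
        unfold TreeCutDecomp.adh
        rw [this]
        simp
      | some l =>
        obtain ⟨e0, he0⟩ := hcut l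
        have hY : ∀ x, x ∈ (starDecomp node).Yset (some l) ↔ node x = some l := by
          intro x
          constructor
          · rintro ⟨u, hu, hx⟩
            have hx' : node x = u := hx
            subst hx'
            cases hn : node x with
            | none =>
              rw [hn] at hu
              have h3 : some l ∈ [(none : Option L)] := hu (SimpleGraph.Walk.nil)
              simp at h3
            | some l' =>
              rw [hn] at hu
              rcases star_walk hu with h | h
              · exact h.symm
              · cases h
          · intro h
            exact ⟨some l, fun p => p.start_mem_support, h⟩
        refine le_trans ?_ hm
        have hsub : {e : Sym2 W | e ∈ G.edgeSet ∧ ∃ x y : W, e = s(x, y) ∧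
            x ∈ (starDecomp node).Yset (some l) ∧ y ∉ (starDecomp node).Yset (some l)} ⊆ {e0} := by
          rintro e ⟨he, x, y, rfl, hx, hy⟩
          rw [hY] at hx hy
          exact he0 x y he hx hy
        exact (Set.ncard_le_ncard hsub).trans (by simp)
    · cases t with
      | none =>
        let B : Finset (W ⊕ Option L) := Finset.univ.image (fun l : L => Sum.inr (some l))
        refine (Multigraph.reducedSize_le _ B ?_ ?_).trans ?_
        · intro x hx
          simp only [B, Finset.mem_image, Finset.mem_univ, true_and] at hx
          obtain ⟨l, rfl⟩ := hx
          right
          refine ⟨some l, ?_, rfl⟩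
          change (SimpleGraph.starGraph (none : Option L)).Adj none (some l)
          simp
        · intro x hx
          simp only [B, Finset.mem_image, Finset.mem_univ, true_and] at hx
          obtain ⟨l, rfl⟩ := hx
          obtain ⟨e0, he0⟩ := hcut l
          have hdiag : ((starDecomp node).torso G none).mult
              s(Sum.inr (some l), Sum.inr (some l)) = 0 := by
            change Set.ncard _ = 0
            rw [Set.ncard_eq_zero (Set.toFinite _), Set.eq_empty_iff_forall_notMem]
            rintro f ⟨-, h1, h2⟩
            rw [h1] at h2
            simp at h2
          have hle : ∀ y : W ⊕ Option L, ((starDecomp node).torso G none).mult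
              s(Sum.inr (some l), y) ≤
              if Sym2.map ((starDecomp node).proj none) e0 = s(Sum.inr (some l), y)
                then 1 else 0 := by
            intro y
            have hsub : {f : Sym2 W | f ∈ G.edgeSet ∧
                Sym2.map ((starDecomp node).proj none) f = s(Sum.inr (some l), y) ∧
                ¬ (Sym2.map ((starDecomp node).proj none) f).IsDiag} ⊆ {e0} := by
              rintro f ⟨h1, h2, h3⟩
              induction f using Sym2.ind with
              | _ a b =>
              have hnode : ∀ z, (starDecomp node).proj none z = Sum.inr (some l) →
                  node z = some l := by
                intro z hz
                cases hn : node z with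
                | none => rw [starDecomp_proj_none node z hn] at hz; cases hz
                | some l' =>
                  rw [starDecomp_proj node z l' hn] at hz
                  simpa using hz
              rw [Sym2.map_mk] at h2 h3
              rw [Sym2.mk_isDiag_iff] at h3
              have hne : ∀ a b, node a = some l →
                 (starDecomp node).proj none a ≠ (starDecomp node).proj none b →
                 node b ≠ some l := by
                intro a b ha h hb
                rw [starDecomp_proj node a l ha, starDecomp_proj node b l hb] at h
                exact h rfl
              rw [Sym2.eq_iff] at h2
              rcases h2 with ⟨h2, -⟩ | ⟨-, h2⟩
              · exact he0 a b h1 (hnode a h2) (hne a b (hnode a h2) h3)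
              · rw [Sym2.eq_swap]
                exact he0 b a h1.symm (hnode b h2) (hne b a (hnode b h2) (Ne.symm h3))
            split_ifs with hc
            · exact (Set.ncard_le_ncard hsub).trans (by simp)
            · change Set.ncard _ ≤ 0
              rw [Nat.le_zero, Set.ncard_eq_zero (Set.toFinite _),
                Set.eq_empty_iff_forall_notMem]
              intro f hf
              have := hsub hf
              rw [Set.mem_singleton_iff] at this
              subst this
              exact hc hf.2.1
          unfold Multigraph.deg
          rw [hdiag, add_zero]
          refine (Finset.sum_le_sum (fun y _ => hle y)).trans ?_
          rw [← Finset.card_filter, Finset.card_le_one]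
          intro a ha b hb
          simp only [Finset.mem_filter, Finset.mem_univ, true_and] at ha hb
          rw [ha] at hb
          exact Sym2.congr_right.mp hb
        · refine le_trans (Set.ncard_le_ncard (t := Sum.inl '' {x | node x = none}) ?_) ?_
          · rintro z ⟨h1 | h1, h2⟩
            · exact h1
            · obtain ⟨s, hs, rfl⟩ := h1
              exfalso
              apply h2
              cases s with
              | none => exact absurd hs (SimpleGraph.irrefl (starDecomp node).T)
              | some l => simp [B]
          · exact (Set.ncard_image_le).trans hroot
      | some l =>
        refine (Multigraph.reducedSize_le _ ∅ (by simp) (by simp)).trans ?_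
        refine le_trans (Set.ncard_le_ncard
          (t := Sum.inl '' {x | node x = some l} ∪ {Sum.inr none}) ?_) ?_
        · rintro z ⟨h1 | h1, -⟩
          · left; exact h1
          · right
            obtain ⟨s, hs, rfl⟩ := h1
            have hs' : (SimpleGraph.starGraph (none : Option L)).Adj (some l) s := hs
            simp at hs'
            simp [hs'.2]
        · refine (Set.ncard_union_le _ _).trans ?_
          rw [Set.ncard_singleton]
          exact (Nat.add_le_add_right (Set.ncard_image_le) 1).trans (hleaf l)
  refine le_trans ?_ key
  unfold tcw
  exact Nat.sInf_le ⟨Option L, inferInstance, starDecomp node, rfl⟩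

/-- Vertices of the gadget (with the two outer vertices `v s`). -/
inductive GV (k : Bool → ℕ) : Type
  | v (s : Bool) | w (s : Bool) | c (s : Bool) | f (s : Bool) | y (s : Bool) | g (s : Bool)
  | a (s : Bool) (i : Fin (k s)) | p (s : Bool) (i : Fin (k s))
  | q (s : Bool) (i : Fin (k s)) | b (s : Bool) (i : Fin (k s))

namespace GV

variable {k : Bool → ℕ}

/-- Concrete model of the vertex type. -/
def toSum : GV k → (Bool × Fin 6) ⊕ (Σ s : Bool, Fin (k s) × Fin 4)
  | v s => Sum.inl (s, 0) | w s => Sum.inl (s, 1) | c s => Sum.inl (s, 2)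
  | f s => Sum.inl (s, 3) | y s => Sum.inl (s, 4) | g s => Sum.inl (s, 5)
  | a s i => Sum.inr ⟨s, i, 0⟩ | p s i => Sum.inr ⟨s, i, 1⟩
  | q s i => Sum.inr ⟨s, i, 2⟩ | b s i => Sum.inr ⟨s, i, 3⟩

/-- Inverse of `toSum`. -/
def ofSum : (Bool × Fin 6) ⊕ (Σ s : Bool, Fin (k s) × Fin 4) → GV k
  | Sum.inl (s, 0) => v s | Sum.inl (s, 1) => w s | Sum.inl (s, 2) => c s
  | Sum.inl (s, 3) => f s | Sum.inl (s, 4) => y s | Sum.inl (s, 5) => g s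
  | Sum.inr ⟨s, i, 0⟩ => a s i | Sum.inr ⟨s, i, 1⟩ => p s i
  | Sum.inr ⟨s, i, 2⟩ => q s i | Sum.inr ⟨s, i, 3⟩ => b s i

/-- The equivalence. -/
def equivSum : ((Bool × Fin 6) ⊕ (Σ s : Bool, Fin (k s) × Fin 4)) ≃ GV k where
  toFun := ofSum
  invFun := toSum
  left_inv := by
    rintro (⟨s, j⟩ | ⟨s, i, j⟩) <;> fin_cases j <;> rfl
  right_inv := by intro x; cases x <;> rfl

instance : Fintype (GV k) := Fintype.ofEquiv _ equivSum

theorem sum_eq (F : GV k → ℕ) : ∑ x, F x =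
    (∑ s, (F (v s) + F (w s) + F (c s) + F (f s) + F (y s) + F (g s))) +
    ∑ s, ∑ i, (F (a s i) + F (p s i) + F (q s i) + F (b s i)) := by
  rw [← Equiv.sum_comp equivSum, Fintype.sum_sum_type, Fintype.sum_prod_type,
    Fintype.sum_sigma]
  congr 1
  · refine Finset.sum_congr rfl fun s _ => ?_
    rw [Fin.sum_univ_six]; rfl
  · refine Finset.sum_congr rfl fun s _ => ?_
    rw [Fintype.sum_prod_type]
    refine Finset.sum_congr rfl fun i _ => ?_
    rw [Fin.sum_univ_four]; rfl

theorem card_eq : Fintype.card (GV k) = 12 + 4 * (k false + k true) := by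
  rw [← Finset.card_univ, Finset.card_eq_sum_ones, sum_eq]
  simp
  ring

/-- Oriented edges. -/
inductive E : GV k → GV k → Prop
  | vw (s) : E (v s) (w s)
  | wc (s) : E (w s) (c s)
  | cf (s) : E (c s) (f s)
  | fy (s) : E (f s) (y s)
  | yg (s) : E (y s) (g s)
  | gg : E (g false) (g true)
  | cp (s i) : E (c s) (p s i)
  | pa (s i) : E (p s i) (a s i)
  | pq (s i) : E (p s i) (q s i)
  | qb (s i) : E (q s i) (b s i)

/-- The acceptability graph. -/
def H : SimpleGraph (GV k) where
  Adj x y := E x y ∨ E y x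
  symm := ⟨fun _ _ h => h.symm⟩
  loopless := ⟨by intro x h; rcases h with h | h <;> cases h⟩

/-- Finite ranks. -/
def rank (j : Bool → ℕ) : GV k → GV k → ℕ
  | v s, _ => j s
  | c _, f _ => 0
  | c _, p _ _ => 1
  | c _, w _ => 2
  | p _ _, q _ _ => 0
  | p _ _, c _ => 1
  | p _ _, a _ _ => 2
  | _, _ => 0

/-- Ranks. -/
def rk (j : Bool → ℕ) (x y : GV k) : ℕ∞ := if x = y then ⊤ else (rank j x y : ℕ∞)

theorem rk_self (j : Bool → ℕ) (x : GV k) : rk j x x = ⊤ := if_pos rfl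

theorem rk_ne (j : Bool → ℕ) {x y : GV k} (h : x ≠ y) : rk j x y = (rank j x y : ℕ∞) := if_neg h

/-- The optimal matching for the choice `t`. -/
def opt (t : Bool → Bool) : GV k → GV k
  | v s => if t s then w s else v s
  | w s => if t s then v s else c s
  | c s => if t s then f s else w s
  | f s => if t s then c s else y s
  | y s => if t s then (if t (!s) then g s else y s) else f s
  | g s => if t s && t (!s) then y s else g (!s)
  | a s i => if t s then p s i else a s i
  | p s i => if t s then a s i else q s i
  | q s i => if t s then b s i else p s i
  | b s i => if t s then q s i else b s i


theorem opt_invol (t : Bool → Bool) (x : GV k) : opt t (opt t x) = x := by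
  rcases x with s | s | s | s | s | s | ⟨s, i⟩ | ⟨s, i⟩ | ⟨s, i⟩ | ⟨s, i⟩ <;>
    cases h : t s <;> cases h' : t (!s) <;> simp [opt, h, h']

theorem opt_adj (t : Bool → Bool) (x : GV k) (hx : opt t x ≠ x) : H.Adj x (opt t x) := by
  rcases x with s | s | s | s | s | s | ⟨s, i⟩ | ⟨s, i⟩ | ⟨s, i⟩ | ⟨s, i⟩ <;>
    cases h : t s <;> cases h' : t (!s) <;> simp [opt, h, h'] at hx ⊢
  all_goals first
    | exact Or.inl (by constructor)
    | exact Or.inr (by constructor)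
    | (cases s
       · exact Or.inl (by constructor)
       · exact Or.inr (by constructor))

/-- The optimal matching. -/
def optM (t : Bool → Bool) : Matching (H (k := k)) where
  partner := opt t
  involutive := opt_invol t
  adj_of_ne := opt_adj t

/-- The vertex cover. -/
def inX (t : Bool → Bool) : GV k → Bool
  | w _ => true
  | f _ => true
  | g s => t s || (!s && !(t true))
  | p _ _ => true
  | q s _ => t s
  | _ => false

theorem inX_card (t : Bool → Bool) : {x : GV k | inX t x = true}.ncard =
    5 + (cond (t false) (2 * k false) (k false)) + (cond (t true) (2 * k true) (k true)) +
      (cond (t false && t true) 1 0) := by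
  have : {x : GV k | inX t x = true} =
      ((Finset.univ.filter (fun x : GV k => inX t x = true) : Finset (GV k)) : Set (GV k)) := by
    ext; simp
  rw [this, Set.ncard_coe_finset, Finset.card_filter, sum_eq]
  cases h : t false <;> cases h' : t true <;> simp [inX, h, h'] <;> ring

theorem mem_edgeSet_iff {V : Type} {G : SimpleGraph V} (M : Matching G) {x z : V} (h : x ≠ z) :
    s(x, z) ∈ M.edgeSet ↔ M.partner x = z := by
  constructor
  · rintro ⟨u, hu, he⟩
    rw [Sym2.eq_iff] at he
    rcases he with ⟨rfl, rfl⟩ | ⟨rfl, rfl⟩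
    · rfl
    · exact M.involutive _
  · rintro rfl
    exact ⟨x, h.symm, rfl⟩

theorem opt_count (t : Bool → Bool) :
    {x : GV k | inX t x = true}.ncard ≤ (optM (k := k) t).edgeSet.ncard := by
  have hne : ∀ x : GV k, inX t x = true → opt t x ≠ x ∧ inX t (opt t x) = false := by
    intro x hx
    rcases x with s | s | s | s | s | s | ⟨s, i⟩ | ⟨s, i⟩ | ⟨s, i⟩ | ⟨s, i⟩ <;>
      cases s <;> cases h : t true <;> cases h' : t false <;> simp [opt, inX, h, h'] at hx ⊢
  refine Set.ncard_le_ncard_of_injOn (fun x => s(x, opt t x)) ?_ ?_ (Set.toFinite _)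
  · intro x hx
    exact ⟨x, (hne x hx).1, rfl⟩
  · intro x hx z hz h
    simp only [Sym2.eq_iff] at h
    rcases h with h | h
    · exact h.1
    · have := (hne x hx).2
      rw [h.2] at this
      rw [Set.mem_ofPred_eq] at hz
      rw [this] at hz
      cases hz

theorem opt_stable (j : Bool → ℕ) (t : Bool → Bool) :
    Stable (H (k := k)) (rk j) (optM t) := by
  have hE : ∀ x z : GV k, E x z → rk j x z < rk j x (opt t x) →
      rk j z x < rk j z (opt t z) → False := by
    intro x z h h1 h2
    rcases h with s | s | s | s | s | _ | ⟨s, i⟩ | ⟨s, i⟩ | ⟨s, i⟩ | ⟨s, i⟩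
    case gg =>
      cases h : t true <;> cases h' : t false <;> simp [opt, rk, rank, h, h'] at h1 h2
    all_goals
      cases h : t s <;> cases h' : t (!s) <;> simp [opt, rk, rank, h, h'] at h1 h2
  rintro x z ⟨h | h, h1, h2⟩
  · exact hE x z h h1 h2
  · exact hE z x h h2 h1

theorem adj_v {s} {z : GV k} (h : H.Adj (v s) z) : z = w s := by
  rcases h with h | h <;> cases h <;> simp
theorem adj_w {s} {z : GV k} (h : H.Adj (w s) z) : z = v s ∨ z = c s := by
  rcases h with h | h <;> cases h <;> simp
theorem adj_f {s} {z : GV k} (h : H.Adj (f s) z) : z = c s ∨ z = y s := by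
  rcases h with h | h <;> cases h <;> simp
theorem adj_p {s i} {z : GV k} (h : H.Adj (p s i) z) : z = c s ∨ z = a s i ∨ z = q s i := by
  rcases h with h | h <;> cases h <;> simp

theorem forced {j : Bool → ℕ} {M : Matching (H (k := k))} (hM : Stable H (rk j) M) {s : Bool}
    (hs : M.partner (v s) ≠ w s) :
    M.partner (w s) = c s ∧ M.partner (f s) = y s ∧ ∀ i, M.partner (p s i) = q s i := by
  have hv : M.partner (v s) = v s := by
    by_contra h
    exact hs (adj_v (M.adj_of_ne _ h))
  have hw : M.partner (w s) = c s := by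
    by_cases h : M.partner (w s) = w s
    · exfalso
      refine hM (v s) (w s) ⟨Or.inl (E.vw s), ?_, ?_⟩
      · rw [hv]; simp [rk]
      · rw [h]; simp [rk]
    · rcases adj_w (M.adj_of_ne _ h) with h1 | h1
      · have := M.involutive (w s)
        rw [h1] at this
        exact absurd this hs
      · exact h1
  have hc : M.partner (c s) = w s := by
    rw [← hw]; exact M.involutive _
  refine ⟨hw, ?_, ?_⟩
  · by_cases h : M.partner (f s) = f s
    · exfalso
      refine hM (c s) (f s) ⟨Or.inl (E.cf s), ?_, ?_⟩
      · rw [hc]; simp [rk, rank]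
      · rw [h]; simp [rk]
    · rcases adj_f (M.adj_of_ne _ h) with h1 | h1
      · have := M.involutive (f s)
        rw [h1, hc] at this
        cases this
      · exact h1
  · intro i
    have hb : ¬ (rk j (p s i) (c s) < rk j (p s i) (M.partner (p s i))) := by
      intro h
      refine hM (c s) (p s i) ⟨Or.inl (E.cp s i), ?_, h⟩
      rw [hc]; simp [rk, rank]
    by_cases h : M.partner (p s i) = p s i
    · exfalso
      apply hb
      rw [h]; simp [rk]
    · rcases adj_p (M.adj_of_ne _ h) with h1 | h1 | h1
      · have := M.involutive (p s i)
        rw [h1, hc] at this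
        cases this
      · exfalso
        apply hb
        rw [h1]; simp [rk, rank]
      · exact h1

theorem upper {j : Bool → ℕ} {M : Matching (H (k := k))} (hM : Stable H (rk j) M)
    (t : Bool → Bool) (ht : ∀ s, M.partner (v s) = w s ↔ t s = true) :
    M.edgeSet.ncard ≤ {x : GV k | inX t x = true}.ncard := by
  have hF : ∀ s, t s = false → M.partner (f s) = y s ∧ ∀ i, M.partner (p s i) = q s i := by
    intro s hs
    refine (forced hM ?_).2
    rw [Ne, ht, hs]
    simp
  have hE : ∀ x z : GV k, E x z → M.partner x = z → inX t x = true ∨ inX t z = true := by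
    intro x z h hxz
    cases h with
    | vw s => simp [inX]
    | wc s => simp [inX]
    | cf s => simp [inX]
    | fy s => simp [inX]
    | cp s i => simp [inX]
    | pa s i => simp [inX]
    | pq s i => simp [inX]
    | gg => cases h : t true <;> simp [inX, h]
    | yg s =>
      cases h : t s with
      | true => simp [inX, h]
      | false =>
        have h1 := (hF s h).1
        have h2 := M.involutive (f s)
        rw [h1, hxz] at h2
        cases h2
    | qb s i =>
      cases h : t s with
      | true => simp [inX, h]
      | false =>
        have h1 := (hF s h).2 i
        have h2 := M.involutive (p s i)
        rw [h1, hxz] at h2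
        cases h2
  have hsub : M.edgeSet ⊆ (fun x => s(x, M.partner x)) '' {x : GV k | inX t x = true} := by
    rintro e ⟨x, hx, rfl⟩
    have h : inX t x = true ∨ inX t (M.partner x) = true := by
      rcases M.adj_of_ne x hx with h | h
      · exact hE _ _ h rfl
      · exact (hE _ _ h (M.involutive x)).symm
    rcases h with h | h
    · exact ⟨x, h, rfl⟩
    · refine ⟨M.partner x, h, ?_⟩
      simp only [M.involutive]
      exact Sym2.eq_swap
  exact (Set.ncard_le_ncard hsub).trans Set.ncard_image_le

/-- Node of the star decomposition. -/
def node : GV k → Option (Σ s : Bool, Fin (k s))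
  | a s i => some ⟨s, i⟩
  | p s i => some ⟨s, i⟩
  | q s i => some ⟨s, i⟩
  | b s i => some ⟨s, i⟩
  | _ => none

/-- Transport of a matching along an equivalence. -/
def transport {V W : Type} (e : V ≃ W) {G : SimpleGraph V} {G' : SimpleGraph W}
    (hG : ∀ x z, G.Adj x z ↔ G'.Adj (e x) (e z)) (M : Matching G) : Matching G' where
  partner x := e (M.partner (e.symm x))
  involutive x := by simp [M.involutive]
  adj_of_ne x h := by
    have := M.adj_of_ne (e.symm x) (by
      intro h'
      rw [h'] at h
      simp at h)
    rw [hG] at this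
    simpa using this

theorem transport_edgeSet {V W : Type} (e : V ≃ W) {G : SimpleGraph V} {G' : SimpleGraph W}
    (hG : ∀ x z, G.Adj x z ↔ G'.Adj (e x) (e z)) (M : Matching G) :
    (transport e hG M).edgeSet.ncard = M.edgeSet.ncard := by
  have : (transport e hG M).edgeSet = Sym2.map e '' M.edgeSet := by
    ext z
    constructor
    · rintro ⟨x, hx, rfl⟩
      refine ⟨s(e.symm x, M.partner (e.symm x)), ⟨e.symm x, ?_, rfl⟩, ?_⟩
      · intro h
        apply hx
        simp [transport, h]
      · simp [transport]
    · rintro ⟨_, ⟨x, hx, rfl⟩, rfl⟩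
      refine ⟨e x, ?_, ?_⟩
      · simpa [transport] using hx
      · simp [transport]
  rw [this, Set.ncard_image_of_injective _ (Sym2.map.injective e.injective)]

theorem gadget_tcw {W : Type} [Fintype W] (G : SimpleGraph W) (φ : W → GV k)
    (hinj : Function.Injective φ) (hnv : ∀ x s, φ x ≠ v s)
    (hsurj : ∀ z : GV k, (∀ s, z ≠ v s) → ∃ x, φ x = z)
    (hG : ∀ x z, G.Adj x z → H.Adj (φ x) (φ z)) : tcw G ≤ 10 := by
  refine tcw_star G (fun x => node (φ x)) 10 (by norm_num) ?_ ?_ ?_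
  · refine (Set.ncard_le_ncard_of_injOn
      (t := {z : GV k | node z = none ∧ ∀ s, z ≠ v s}) φ ?_ hinj.injOn (Set.toFinite _)).trans ?_
    · intro x hx
      exact ⟨hx, hnv x⟩
    · have : {z : GV k | node z = none ∧ ∀ s, z ≠ v s} = ((Finset.univ.filter
          (fun z : GV k => node z = none ∧ ∀ s, z ≠ v s) : Finset (GV k)) : Set (GV k)) := by
        ext; simp
      rw [this, Set.ncard_coe_finset, Finset.card_filter, sum_eq]
      simp [node]
  · rintro ⟨s, i⟩
    have h4 : ({a s i, p s i, q s i, b s i} : Set (GV k)).ncard ≤ 4 := by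
      have : ({a s i, p s i, q s i, b s i} : Set (GV k)) =
        (({a s i, p s i, q s i, b s i} : Finset (GV k)) : Set (GV k)) := by simp
      rw [this, Set.ncard_coe_finset]
      exact Finset.card_le_four
    refine le_trans (Nat.add_le_add_right (Set.ncard_le_ncard_of_injOn
      (t := {a s i, p s i, q s i, b s i}) φ ?_ hinj.injOn (Set.toFinite _)) 1) (by omega)
    intro x hx
    have hx' : node (φ x) = some ⟨s, i⟩ := hx
    rcases h : φ x with s' | s' | s' | s' | s' | s' | ⟨s', i'⟩ | ⟨s', i'⟩ | ⟨s', i'⟩ | ⟨s', i'⟩ <;>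
      rw [h] at hx' <;> simp only [node] at hx' <;> cases hx' <;> simp
  · rintro ⟨s, i⟩
    obtain ⟨x0, hx0⟩ := hsurj (p s i) (by simp)
    obtain ⟨z0, hz0⟩ := hsurj (c s) (by simp)
    refine ⟨s(x0, z0), ?_⟩
    intro x z hxz hx hz
    have key : ∀ x z : GV k, H.Adj x z → node x = some ⟨s, i⟩ → node z ≠ some ⟨s, i⟩ →
        x = p s i ∧ z = c s := by
      intro x z h h1 h2
      rcases h with h | h <;> cases h <;> simp only [node] at h1 h2
      all_goals first
        | exact absurd h1 h2
        | (cases h1; done)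
        | (cases h1; exact ⟨rfl, rfl⟩)
    obtain ⟨h1, h2⟩ := key _ _ (hG _ _ hxz) hx hz
    rw [hinj (h1.trans hx0.symm), hinj (h2.trans hz0.symm)]

end GV

/-- **edge gadget.** There is a constant `C` such that for all
`k₁, k₂, j₁, j₂ ∈ ℕ` there is an SRTI instance (on at most `C·(k₁+k₂+1)` vertices)
consisting of a gadget together with two outer vertices `v₁`, `v₂`, where the only edge
incident to `vᵢ` is `eᵢ = {vᵢ, wᵢ}` with `wᵢ` in the gadget and `rk_{vᵢ}(wᵢ) = jᵢ`,
such that for every subset `S ⊆ {e₁, e₂}` (encoded by Booleans `b₁ b₂`) there is a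
stable matching `M` with `M ∩ {e₁, e₂} = S`, and among all such stable matchings the
maximum number of edges with at least one endpoint in the gadget equals
`6 + 2k₁ + 2k₂` if `S = {e₁, e₂}`, `5 + 2kᵢ + k_{3−i}` if `S = {eᵢ}`, and
`5 + k₁ + k₂` if `S = ∅`.  Moreover the gadget has tree-cut width at most `10`. -/
theorem edge_gadget :
    ∃ C : ℕ, ∀ k₁ k₂ j₁ j₂ : ℕ,
    ∃ (n : ℕ) (H : SimpleGraph (Fin n)) (rk : Fin n → Fin n → ℕ∞)
      (v₁ w₁ v₂ w₂ : Fin n),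
      (∀ v, rk v v = ⊤) ∧
      (∀ v u, H.Adj v u → rk v u ≠ ⊤) ∧
      v₁ ≠ v₂ ∧ w₁ ≠ v₂ ∧ w₂ ≠ v₁ ∧
      H.Adj v₁ w₁ ∧ (∀ x, H.Adj v₁ x → x = w₁) ∧
      H.Adj v₂ w₂ ∧ (∀ x, H.Adj v₂ x → x = w₂) ∧
      rk v₁ w₁ = (j₁ : ℕ∞) ∧ rk v₂ w₂ = (j₂ : ℕ∞) ∧
      (∀ b₁ b₂ : Bool,
        (∃ M : Matching H, Stable H rk M ∧
          (s(v₁, w₁) ∈ M.edgeSet ↔ b₁ = true) ∧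
          (s(v₂, w₂) ∈ M.edgeSet ↔ b₂ = true) ∧
          gadgetEdgeCount v₁ v₂ M =
            5 + (cond b₁ (2 * k₁) k₁) + (cond b₂ (2 * k₂) k₂) +
              (cond (b₁ && b₂) 1 0)) ∧
        (∀ M : Matching H, Stable H rk M →
          (s(v₁, w₁) ∈ M.edgeSet ↔ b₁ = true) →
          (s(v₂, w₂) ∈ M.edgeSet ↔ b₂ = true) →
          gadgetEdgeCount v₁ v₂ M ≤
            5 + (cond b₁ (2 * k₁) k₁) + (cond b₂ (2 * k₂) k₂) +
              (cond (b₁ && b₂) 1 0))) ∧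
      n ≤ C * (k₁ + k₂ + 1) ∧
      tcw (SimpleGraph.comap
        (Subtype.val : {x : Fin n // x ≠ v₁ ∧ x ≠ v₂} → Fin n) H) ≤ 10 := by
  refine ⟨12, fun k₁ k₂ j₁ j₂ => ?_⟩
  let k : Bool → ℕ := fun s => cond s k₂ k₁
  let j : Bool → ℕ := fun s => cond s j₂ j₁
  let e : GV k ≃ Fin (Fintype.card (GV k)) := Fintype.equivFin _
  let H' : SimpleGraph (Fin (Fintype.card (GV k))) := SimpleGraph.comap e.symm GV.H
  have hG : ∀ x z : GV k, GV.H.Adj x z ↔ H'.Adj (e x) (e z) := by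
    intro x z
    simp [H']
  have hG' : ∀ x z, H'.Adj x z ↔ (GV.H (k := k)).Adj (e.symm x) (e.symm z) := fun x z => Iff.rfl
  have hvw : ∀ s s' : Bool, e (GV.v s) ≠ e (GV.w s') := by
    intro s s' h
    cases e.injective h
  have hcount : ∀ M : Matching H',
      gadgetEdgeCount (e (GV.v false)) (e (GV.v true)) M = M.edgeSet.ncard := by
    intro M
    unfold gadgetEdgeCount
    congr 1
    ext z
    refine ⟨fun h => h.1, fun h => ⟨h, ?_⟩⟩
    obtain ⟨x, hx, rfl⟩ := h
    have hadj := M.adj_of_ne x hx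
    by_cases hxv : ∃ s, x = e (GV.v s)
    · obtain ⟨s, rfl⟩ := hxv
      refine ⟨M.partner (e (GV.v s)), by simp, ?_⟩
      rw [hG', Equiv.symm_apply_apply] at hadj
      have h1 := GV.adj_v hadj
      rw [Equiv.symm_apply_eq] at h1
      rw [h1]
      exact ⟨(hvw _ _).symm, (hvw _ _).symm⟩
    · push Not at hxv
      exact ⟨x, by simp, hxv _, hxv _⟩
  refine ⟨Fintype.card (GV k), H', fun x z => GV.rk j (e.symm x) (e.symm z),
    e (GV.v false), e (GV.w false), e (GV.v true), e (GV.w true), ?_, ?_, ?_, ?_, ?_, ?_, ?_, ?_,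
    ?_, ?_, ?_, ?_, ?_, ?_⟩
  · intro x
    exact GV.rk_self _ _
  · intro x z h
    simp only
    rw [GV.rk_ne _ (SimpleGraph.Adj.ne ((hG' x z).1 h))]
    exact ENat.natCast_ne_top _
  · intro h
    cases e.injective h
  · exact (hvw _ _).symm
  · exact (hvw _ _).symm
  · exact (hG _ _).1 (Or.inl (GV.E.vw _))
  · intro x hx
    rw [hG', Equiv.symm_apply_apply] at hx
    exact (Equiv.symm_apply_eq e).1 (GV.adj_v hx)
  · exact (hG _ _).1 (Or.inl (GV.E.vw _))
  · intro x hx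
    rw [hG', Equiv.symm_apply_apply] at hx
    exact (Equiv.symm_apply_eq e).1 (GV.adj_v hx)
  · simp [GV.rk, GV.rank, j]
  · simp [GV.rk, GV.rank, j]
  · intro b₁ b₂
    let t : Bool → Bool := fun s => cond s b₂ b₁
    have hX := GV.inX_card (k := k) t
    constructor
    · refine ⟨GV.transport e hG (GV.optM t), ?_, ?_, ?_, ?_⟩
      · rintro x z ⟨h1, h2, h3⟩
        refine GV.opt_stable j t (e.symm x) (e.symm z) ⟨h1, ?_, ?_⟩
        · simpa [GV.transport] using h2
        · simpa [GV.transport] using h3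
      · rw [GV.mem_edgeSet_iff _ (hvw _ _)]
        cases b₁ <;> simp [GV.transport, GV.optM, GV.opt, t]
      · rw [GV.mem_edgeSet_iff _ (hvw _ _)]
        cases b₂ <;> simp [GV.transport, GV.optM, GV.opt, t]
      · rw [hcount, GV.transport_edgeSet]
        refine Eq.trans (le_antisymm ?_ (GV.opt_count t)) hX
        refine GV.upper (GV.opt_stable j t) t ?_
        intro s
        change GV.opt t (GV.v s) = GV.w s ↔ _
        cases h : t s <;> simp [GV.opt, h]
    · intro M hM h1 h2
      rw [GV.mem_edgeSet_iff _ (hvw _ _)] at h1 h2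
      rw [hcount]
      let M' : Matching (GV.H (k := k)) := GV.transport e.symm hG' M
      rw [← GV.transport_edgeSet e.symm hG' M]
      refine le_trans (GV.upper (j := j) ?_ t ?_) hX.le
      · rintro x z ⟨h3, h4, h5⟩
        refine hM (e x) (e z) ⟨(hG _ _).1 h3, ?_, ?_⟩
        · simpa [GV.transport] using h4
        · simpa [GV.transport] using h5
      · intro s
        change e.symm (M.partner (e.symm.symm (GV.v s))) = _ ↔ _
        rw [Equiv.symm_apply_eq, Equiv.symm_symm]
        cases s
        · exact h1
        · exact h2
  · rw [GV.card_eq]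
    simp only [k, cond_true, cond_false]
    omega
  · refine GV.gadget_tcw _ (fun x => e.symm x.1) ?_ ?_ ?_ ?_
    · exact e.symm.injective.comp Subtype.val_injective
    · rintro ⟨x, hx1, hx2⟩ s h
      simp only at h
      rw [Equiv.symm_apply_eq] at h
      cases s
      · exact hx1 h
      · exact hx2 h
    · intro z hz
      refine ⟨⟨e z, ?_, ?_⟩, by simp⟩
      · intro h; exact hz _ (e.injective h)
      · intro h; exact hz _ (e.injective h)
    · intro x z h
      exact h

end
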